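/- Fix l = 2m+1, m > 0, and r prime to l. Let N be the ideal of ℤ/2[x₁,…,x_m] generated by the elements R_{i,j} = x_i^4·x_{2j} + x_j^4·x_{2i} + x_{2i}·x_{2j} + x_{i+j}²·x_{i−j}² for m ≥ i > j ≥ 1 (indices read via x_{l−k} = x_k). Let u, v ∈ ℤ/2[x₁,…,x_m] and suppose the ideals (N, v) and (N, u, v) coincide. Then φ_r(u) lies in the principal ideal of S generated by φ_r(v); in particular, if φ_r(v) ≠ 0 then the element φ_r(u)/φ_r(v) of the field of fractions of S lies in S. -/

import Mathlib

open scoped Classical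

/-- The theta series `[i]` for modulus `l`: `∑ x^(n²)` over integers `n ≡ i (mod l)`,
viewed in `ℤ/2[[x]]` (the coefficient of `x^k` is the mod-2 count of such `n` with `n² = k`). -/
noncomputable def theta (l i : ℤ) : PowerSeries (ZMod 2) :=
  PowerSeries.mk fun k => (({n : ℤ | n ≡ i [ZMOD l] ∧ n ^ 2 = (k : ℤ)}.ncard : ℕ) : ZMod 2)

/-- The theta series viewed in the Laurent series field `L = ℤ/2((x))`. -/
noncomputable def thetaL (l i : ℤ) : LaurentSeries (ZMod 2) := (theta l i : LaurentSeries (ZMod 2))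

/-- The projection `p_{q,j}` keeping only the coefficients in degrees `≡ j (mod q)`. -/
noncomputable def proj (q j : ℤ) (f : LaurentSeries (ZMod 2)) : LaurentSeries (ZMod 2) where
  coeff n := if n ≡ j [ZMOD q] then f.coeff n else 0
  isPWO_support' := f.isPWO_support'.mono (fun n hn => by
    simp only [Function.mem_support, ne_eq] at hn ⊢
    intro h; apply hn; split_ifs <;> simp [h])

/-- `B(g)`: the set of integers `n` such that the coefficient of `x^n` in `1/g` is `1`. -/
noncomputable def Bset (g : PowerSeries (ZMod 2)) : Set ℤ :=
  {n : ℤ | ((g : LaurentSeries (ZMod 2))⁻¹).coeff n = 1}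

/-- The subring `S` of `L` generated over `ℤ/2` by `[1], …, [m]`. -/
noncomputable def Sring (l : ℤ) (m : ℕ) : Subring (LaurentSeries (ZMod 2)) :=
  Subring.closure {x | ∃ i : ℕ, 1 ≤ i ∧ i ≤ m ∧ x = thetaL l i}

/-- The subring `S` of `ℤ/2[[x]]` generated over `ℤ/2` by `[1], …, [m]`. -/
noncomputable def SringPS (l : ℤ) (m : ℕ) : Subring (PowerSeries (ZMod 2)) :=
  Subring.closure {x | ∃ i : ℕ, 1 ≤ i ∧ i ≤ m ∧ x = theta l i}

/-- The variable `x_k` of `ℤ/2[x₁, …, x_m]` for an integer index `k`, where indices are read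
mod `l = 2m+1` up to sign (so `x_{l-k} = x_k`); indices `≡ 0 (mod l)` give `0` (unused). -/
noncomputable def xvar (m : ℕ) (k : ℤ) : MvPolynomial (Fin m) (ZMod 2) :=
  if h : 1 ≤ (k % (2 * (m : ℤ) + 1)).toNat ∧ (k % (2 * (m : ℤ) + 1)).toNat ≤ m then
    MvPolynomial.X ⟨(k % (2 * (m : ℤ) + 1)).toNat - 1, by omega⟩
  else if h2 : m + 1 ≤ (k % (2 * (m : ℤ) + 1)).toNat ∧ (k % (2 * (m : ℤ) + 1)).toNat ≤ 2 * m then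
    MvPolynomial.X ⟨2 * m - (k % (2 * (m : ℤ) + 1)).toNat, by omega⟩
  else 0

/-- The quintic relation `R_{i,j} = x_i⁴·x_{2j} + x_j⁴·x_{2i} + x_{2i}·x_{2j} + x_{i+j}²·x_{i-j}²`. -/
noncomputable def QRel (m : ℕ) (i j : ℤ) : MvPolynomial (Fin m) (ZMod 2) :=
  xvar m i ^ 4 * xvar m (2 * j) + xvar m j ^ 4 * xvar m (2 * i) +
    xvar m (2 * i) * xvar m (2 * j) + xvar m (i + j) ^ 2 * xvar m (i - j) ^ 2

/-- The homomorphism `φ_r : ℤ/2[x₁, …, x_m] → ℤ/2[[x]]` sending `x_k` to `[rk]`. -/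
noncomputable def phi (l : ℤ) (m : ℕ) (r : ℤ) :
    MvPolynomial (Fin m) (ZMod 2) →+* PowerSeries (ZMod 2) :=
  (MvPolynomial.aeval fun k : Fin m => theta l (r * ((k : ℕ) + 1))).toRingHom

/-- The ideal `N` generated by the quintic relations `R_{i,j}`, `m ≥ i > j ≥ 1`. -/
noncomputable def Nideal (m : ℕ) : Ideal (MvPolynomial (Fin m) (ZMod 2)) :=
  Ideal.span {P | ∃ i j : ℤ, 1 ≤ j ∧ j < i ∧ i ≤ (m : ℤ) ∧ P = QRel m i j}

section ThetaSeries

open PowerSeries PowerSeries.WithPiTopology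

local instance : TopologicalSpace (ZMod 2) := ⊥

local instance : DiscreteTopology (ZMod 2) := ⟨rfl⟩

/-- The monomial `x^(n²)` if `P n` holds, and `0` otherwise. -/
noncomputable def squareTerm (P : ℤ → Prop) (n : ℤ) : PowerSeries (ZMod 2) :=
  if P n then X ^ (n.natAbs ^ 2) else 0

/-- The series `∑ x^(n²)` over the integers `n` satisfying `P`. -/
noncomputable def squareSeries (P : ℤ → Prop) : PowerSeries (ZMod 2) :=
  PowerSeries.mk fun k => (({n : ℤ | P n ∧ n ^ 2 = (k : ℤ)}.ncard : ℕ) : ZMod 2)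

theorem finite_setOf_sq_eq (k : ℕ) : {n : ℤ | n ^ 2 = (k : ℤ)}.Finite :=
  (Set.finite_Icc (-(k : ℤ)) k).subset fun n (hn : n ^ 2 = (k : ℤ)) =>
    ⟨by nlinarith, by nlinarith⟩

theorem eq_natAbs_sq_iff (k : ℕ) (n : ℤ) : k = n.natAbs ^ 2 ↔ n ^ 2 = (k : ℤ) := by
  rw [← Int.natAbs_sq n]
  norm_cast
  exact eq_comm

theorem hasSum_squareTerm (P : ℤ → Prop) : HasSum (squareTerm P) (squareSeries P) := by
  refine (hasSum_iff_hasSum_coeff _).2 fun k => ?_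
  have hfin : {n : ℤ | P n ∧ n ^ 2 = (k : ℤ)}.Finite :=
    (finite_setOf_sq_eq k).subset fun n hn => hn.2
  have key : ∀ n, coeff k (squareTerm P n) = if P n ∧ n ^ 2 = (k : ℤ) then 1 else 0 := by
    intro n
    by_cases hP : P n <;> simp [squareTerm, hP, coeff_X_pow, eq_natAbs_sq_iff]
  have hsum : coeff k (squareSeries P) = ∑ n ∈ hfin.toFinset, coeff k (squareTerm P n) := by
    rw [Finset.sum_congr rfl fun n hn => by
      rw [key n, if_pos (by simpa using hn)]]
    simp [squareSeries, Set.ncard_eq_toFinset_card _ hfin]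
  rw [hsum]
  refine hasSum_sum_of_ne_finset_zero fun n hn => ?_
  rw [key n, if_neg (by simpa using hn)]

theorem hasSum_squareTerm_mul (P Q : ℤ → Prop) :
    HasSum (fun p : ℤ × ℤ => squareTerm P p.1 * squareTerm Q p.2)
      (squareSeries P * squareSeries Q) := by
  refine (hasSum_squareTerm P).mul (hasSum_squareTerm Q) ?_
  refine (summable_iff_summable_coeff _).2 fun k => summable_of_hasFiniteSupport ?_
  refine ((Set.finite_Icc (-(k : ℤ)) k).prod (Set.finite_Icc (-(k : ℤ)) k)).subset ?_
  rintro ⟨a, b⟩ h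
  have h' : k = a.natAbs ^ 2 + b.natAbs ^ 2 := by
    by_contra hne
    refine h ?_
    by_cases hP : P a <;> by_cases hQ : Q b <;>
      simp [squareTerm, hP, hQ, ← pow_add, coeff_X_pow, hne]
  zify at h'
  rw [sq_abs, sq_abs] at h'
  simp only [Set.mem_prod, Set.mem_Icc]
  refine ⟨⟨?_, ?_⟩, ?_, ?_⟩ <;> nlinarith [Int.le_self_sq a, Int.le_self_sq b,
    Int.le_self_sq (-a), Int.le_self_sq (-b), sq_nonneg a, sq_nonneg b]

instance : CharP (PowerSeries (ZMod 2)) 2 :=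
  charP_of_injective_ringHom (C_injective (R := ZMod 2)) 2

theorem hasSum_pow_two_pow {ι : Type*} {f : ι → PowerSeries (ZMod 2)} {a : PowerSeries (ZMod 2)}
    (h : HasSum f a) (e : ℕ) : HasSum (fun i => f i ^ 2 ^ e) (a ^ 2 ^ e) :=
  h.map (iterateFrobenius (PowerSeries (ZMod 2)) 2 e) (continuous_pow (2 ^ e))

theorem squareTerm_pow (P : ℤ → Prop) (n : ℤ) {e : ℕ} (he : e ≠ 0) :
    squareTerm P n ^ e = if P n then X ^ (e * n.natAbs ^ 2) else 0 := by
  by_cases hP : P n <;> simp [squareTerm, hP, he, ← pow_mul, mul_comm]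

theorem squareTerm_mul (P Q : ℤ → Prop) (a b : ℤ) :
    squareTerm P a * squareTerm Q b =
      if P a ∧ Q b then X ^ (a.natAbs ^ 2 + b.natAbs ^ 2) else 0 := by
  by_cases hP : P a <;> by_cases hQ : Q b <;> simp [squareTerm, hP, hQ, pow_add]

theorem two_mul_modEq_two_mul {l : ℤ} (hl : Odd l) (a b : ℤ) :
    2 * a ≡ 2 * b [ZMOD l] ↔ a ≡ b [ZMOD l] := by
  refine ⟨fun h => ?_, fun h => h.mul_left 2⟩
  rw [Int.modEq_iff_dvd] at h ⊢
  rw [← mul_sub] at h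
  obtain ⟨k, rfl⟩ := hl
  exact (show IsCoprime (2 * k + 1) 2 from ⟨1, -k, by ring⟩).dvd_of_dvd_mul_left h

theorem theta_eq_squareSeries (l i : ℤ) :
    theta l i = squareSeries fun n => n ≡ i [ZMOD l] :=
  rfl

theorem theta_pow_four {l : ℤ} (hl : Odd l) (i : ℤ) :
    theta l i ^ 4 = squareSeries fun n => n ≡ 2 * i [ZMOD l] ∧ Even n := by
  have hinj : Function.Injective fun n : ℤ => 2 * n := fun a b h => by simpa using h
  have h₂ := hasSum_squareTerm fun n => n ≡ 2 * i [ZMOD l] ∧ Even n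
  rw [← hinj.hasSum_iff] at h₂
  · refine (hasSum_pow_two_pow (hasSum_squareTerm fun n => n ≡ i [ZMOD l]) 2).unique ?_
    convert h₂ using 2 with n
    rw [squareTerm_pow _ _ (by norm_num)]
    simp [squareTerm, two_mul_modEq_two_mul hl, Int.natAbs_mul, mul_pow]
  · intro n hn
    refine if_neg fun h => hn ?_
    obtain ⟨t, rfl⟩ := h.2
    exact ⟨t, two_mul t⟩

theorem squareSeries_even_add_odd (P : ℤ → Prop) :
    (squareSeries fun n => P n ∧ Even n) + (squareSeries fun n => P n ∧ Odd n) =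
      squareSeries P := by
  refine ((hasSum_squareTerm _).add (hasSum_squareTerm _)).unique ?_
  convert hasSum_squareTerm P using 2 with n
  by_cases hP : P n <;> by_cases he : Even n <;> simp [squareTerm, hP, he]

theorem squareSeries_parity_mul {l : ℤ} (hl : Odd l) (i j : ℤ) :
    (squareSeries fun n => n ≡ 2 * i [ZMOD l] ∧ Even n) *
          (squareSeries fun n => n ≡ 2 * j [ZMOD l] ∧ Even n) +
        (squareSeries fun n => n ≡ 2 * i [ZMOD l] ∧ Odd n) *
          (squareSeries fun n => n ≡ 2 * j [ZMOD l] ∧ Odd n) =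
      theta l (i + j) ^ 2 * theta l (i - j) ^ 2 := by
  have hinj : Function.Injective fun p : ℤ × ℤ => (p.1 + p.2, p.1 - p.2) := by
    rintro ⟨a, b⟩ ⟨c, d⟩ h
    simp only [Prod.mk.injEq] at h ⊢
    omega
  have h₁ := (hasSum_squareTerm_mul (fun n => n ≡ 2 * i [ZMOD l] ∧ Even n)
    fun n => n ≡ 2 * j [ZMOD l] ∧ Even n).add
    (hasSum_squareTerm_mul (fun n => n ≡ 2 * i [ZMOD l] ∧ Odd n)
      fun n => n ≡ 2 * j [ZMOD l] ∧ Odd n)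
  rw [← hinj.hasSum_iff] at h₁
  · have h₂ := hasSum_pow_two_pow (hasSum_squareTerm_mul (fun n => n ≡ i + j [ZMOD l])
      fun n => n ≡ i - j [ZMOD l]) 1
    rw [pow_one, mul_pow] at h₂
    rw [theta_eq_squareSeries, theta_eq_squareSeries]
    refine h₁.unique ?_
    convert h₂ using 2 with p
    obtain ⟨s, t⟩ := p
    have hcong : (s + t ≡ 2 * i [ZMOD l] ∧ s - t ≡ 2 * j [ZMOD l]) ↔
        (s ≡ i + j [ZMOD l] ∧ t ≡ i - j [ZMOD l]) := by
      constructor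
      · rintro ⟨h, h'⟩
        rw [← two_mul_modEq_two_mul hl s, ← two_mul_modEq_two_mul hl t]
        exact ⟨by convert h.add h' using 1 <;> ring, by convert h.sub h' using 1 <;> ring⟩
      · rintro ⟨h, h'⟩
        exact ⟨by convert h.add h' using 1; ring, by convert h.sub h' using 1; ring⟩
    have hpar : Even (s - t) ↔ Even (s + t) := by grind
    have hexp : (s + t).natAbs ^ 2 + (s - t).natAbs ^ 2 =
        2 * (s.natAbs ^ 2 + t.natAbs ^ 2) := by
      zify
      simp only [sq_abs]
      ring
    simp only [Function.comp_apply, squareTerm_mul, ite_pow, ← pow_mul, mul_comm _ 2, ← hexp,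
      zero_pow two_ne_zero, ← hcong, ← Int.not_even_iff_odd, hpar]
    by_cases ha : s + t ≡ 2 * i [ZMOD l] <;> by_cases hb : s - t ≡ 2 * j [ZMOD l] <;>
      by_cases he : Even (s + t) <;> simp [ha, hb, he]
  · rintro ⟨a, b⟩ hab
    have hne : ¬ (Even a ↔ Even b) := fun h => hab <| by
      refine ⟨((a + b) / 2, (a - b) / 2), ?_⟩
      simp only [Prod.mk.injEq]
      grind
    by_cases ha : Even a <;> by_cases hb : Even b <;>
      simp_all [squareTerm, ← Int.not_even_iff_odd]

theorem theta_quintic {l : ℤ} (hl : Odd l) (i j : ℤ) :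
    theta l i ^ 4 * theta l (2 * j) + theta l j ^ 4 * theta l (2 * i) +
      theta l (2 * i) * theta l (2 * j) + theta l (i + j) ^ 2 * theta l (i - j) ^ 2 = 0 := by
  rw [← squareSeries_parity_mul hl, theta_pow_four hl, theta_pow_four hl]
  have hsplit : ∀ k, theta l k = (squareSeries fun n => n ≡ k [ZMOD l] ∧ Even n) +
      squareSeries fun n => n ≡ k [ZMOD l] ∧ Odd n := fun k =>
    (squareSeries_even_add_odd fun n => n ≡ k [ZMOD l]).symm
  rw [hsplit (2 * i), hsplit (2 * j)]
  linear_combination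
    (2 * (squareSeries fun n => n ≡ 2 * i [ZMOD l] ∧ Even n) *
        (squareSeries fun n => n ≡ 2 * j [ZMOD l] ∧ Even n) +
      (squareSeries fun n => n ≡ 2 * i [ZMOD l] ∧ Even n) *
        (squareSeries fun n => n ≡ 2 * j [ZMOD l] ∧ Odd n) +
      (squareSeries fun n => n ≡ 2 * j [ZMOD l] ∧ Even n) *
        (squareSeries fun n => n ≡ 2 * i [ZMOD l] ∧ Odd n) +
      (squareSeries fun n => n ≡ 2 * i [ZMOD l] ∧ Odd n) *
        (squareSeries fun n => n ≡ 2 * j [ZMOD l] ∧ Odd n)) * (CharTwo.two_eq_zero (R := PowerSeries (ZMod 2)))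

end ThetaSeries

theorem theta_congr {l i j : ℤ} (h : i ≡ j [ZMOD l]) : theta l i = theta l j := by
  have : ∀ n : ℤ, n ≡ i [ZMOD l] ↔ n ≡ j [ZMOD l] := fun n =>
    ⟨fun hn => hn.trans h, fun hn => hn.trans h.symm⟩
  simp only [theta, this]

theorem theta_neg (l i : ℤ) : theta l (-i) = theta l i := by
  ext k
  simp only [theta, PowerSeries.coeff_mk]
  congr 1
  refine Set.ncard_congr (fun n _ => -n) ?_ (fun a b _ _ h => neg_injective h) ?_
  · rintro n ⟨h, h'⟩
    exact ⟨by simpa using h.neg, by rw [neg_sq]; exact h'⟩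
  · rintro n ⟨h, h'⟩
    exact ⟨-n, ⟨h.neg, by rw [neg_sq]; exact h'⟩, neg_neg n⟩

theorem exists_theta_eq {m : ℕ} {k : ℤ} (hk : ¬ (2 * (m : ℤ) + 1) ∣ k) :
    ∃ i : ℕ, 1 ≤ i ∧ i ≤ m ∧ theta (2 * m + 1) k = theta (2 * m + 1) i := by
  have h0 : k % (2 * (m : ℤ) + 1) ≠ 0 := fun h => hk (Int.dvd_of_emod_eq_zero h)
  have h1 := Int.emod_nonneg k (show (2 * (m : ℤ) + 1) ≠ 0 by omega)
  have h2 := Int.emod_lt_of_pos k (show 0 < 2 * (m : ℤ) + 1 by omega)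
  have h3 : k % (2 * (m : ℤ) + 1) ≡ k [ZMOD 2 * m + 1] := Int.mod_modEq _ _
  generalize k % (2 * (m : ℤ) + 1) = t at h0 h1 h2 h3
  by_cases ht : t ≤ m
  · refine ⟨t.toNat, by omega, by omega, ?_⟩
    rw [Int.toNat_of_nonneg h1]
    exact theta_congr h3.symm
  · refine ⟨(2 * m + 1 - t).toNat, by omega, by omega, ?_⟩
    rw [Int.toNat_of_nonneg (by omega), ← theta_neg]
    refine theta_congr (h3.symm.neg.trans ?_)
    rw [Int.modEq_iff_dvd]
    exact ⟨1, by ring⟩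

theorem phi_xvar {m : ℕ} (r : ℤ) {k : ℤ} (hk : ¬ (2 * (m : ℤ) + 1) ∣ k) :
    phi (2 * m + 1) m r (xvar m k) = theta (2 * m + 1) (r * k) := by
  have h0 : k % (2 * (m : ℤ) + 1) ≠ 0 := fun h => hk (Int.dvd_of_emod_eq_zero h)
  have h1 := Int.emod_nonneg k (show (2 * (m : ℤ) + 1) ≠ 0 by omega)
  have h2 := Int.emod_lt_of_pos k (show 0 < 2 * (m : ℤ) + 1 by omega)
  have h3 : k % (2 * (m : ℤ) + 1) ≡ k [ZMOD 2 * m + 1] := Int.mod_modEq _ _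
  have h4 := Int.toNat_of_nonneg h1
  unfold xvar
  split_ifs with ha hb
  · simp only [phi, AlgHom.toRingHom_eq_coe, RingHom.coe_coe, MvPolynomial.aeval_X]
    refine theta_congr (Int.ModEq.mul_left r ?_)
    convert h3 using 1
    omega
  · simp only [phi, AlgHom.toRingHom_eq_coe, RingHom.coe_coe, MvPolynomial.aeval_X]
    rw [← theta_neg, ← mul_neg]
    refine theta_congr (Int.ModEq.mul_left r (Int.ModEq.trans ?_ h3))
    rw [Int.modEq_iff_dvd]
    exact ⟨1, by omega⟩
  · omega

theorem phi_QRel {m : ℕ} (r : ℤ) {i j : ℤ} (hj : 1 ≤ j) (hij : j < i) (hi : i ≤ m) :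
    phi (2 * m + 1) m r (QRel m i j) = 0 := by
  have hpos : ∀ k : ℤ, 0 < k → k < 2 * m + 1 → ¬ (2 * (m : ℤ) + 1) ∣ k := fun k h h' hd =>
    absurd (Int.le_of_dvd h hd) (by omega)
  simp only [QRel, map_add, map_mul, map_pow]
  rw [phi_xvar r (hpos i (by omega) (by omega)), phi_xvar r (hpos j (by omega) (by omega)),
    phi_xvar r (hpos (2 * i) (by omega) (by omega)),
    phi_xvar r (hpos (2 * j) (by omega) (by omega)),
    phi_xvar r (hpos (i + j) (by omega) (by omega)),
    phi_xvar r (hpos (i - j) (by omega) (by omega)),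
    mul_add, mul_sub, mul_left_comm r 2 i, mul_left_comm r 2 j]
  exact theta_quintic ⟨m, rfl⟩ (r * i) (r * j)

theorem Nideal_le_ker_phi (m : ℕ) (r : ℤ) : Nideal m ≤ RingHom.ker (phi (2 * m + 1) m r) := by
  rw [Nideal, Ideal.span_le]
  rintro _ ⟨i, j, hj, hij, hi, rfl⟩
  exact phi_QRel r hj hij hi

theorem phi_mem_SringPS {m : ℕ} {r : ℤ} (hr : IsCoprime r (2 * m + 1))
    (s : MvPolynomial (Fin m) (ZMod 2)) : phi (2 * m + 1) m r s ∈ SringPS (2 * m + 1) m := by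
  induction s using MvPolynomial.induction_on with
  | C a =>
    obtain ⟨n, rfl⟩ := ZMod.natCast_zmod_surjective a
    simp only [map_natCast]
    exact natCast_mem _ n
  | add p q hp hq =>
    rw [map_add]
    exact add_mem hp hq
  | mul_X p k hp =>
    rw [map_mul]
    refine mul_mem hp ?_
    simp only [phi, AlgHom.toRingHom_eq_coe, RingHom.coe_coe, MvPolynomial.aeval_X]
    have hk : ¬ (2 * (m : ℤ) + 1) ∣ r * ((k : ℕ) + 1) := fun h =>
      absurd (Int.le_of_dvd (by omega) (hr.symm.dvd_of_dvd_mul_left h)) (by omega)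
    exact Subring.subset_closure (exists_theta_eq hk)

theorem coe_mem_Sring {l : ℤ} {m : ℕ} {f : PowerSeries (ZMod 2)} (hf : f ∈ SringPS l m) :
    (f : LaurentSeries (ZMod 2)) ∈ Sring l m := by
  have hle : SringPS l m ≤ (Sring l m).comap (HahnSeries.ofPowerSeries ℤ (ZMod 2)) := by
    rw [SringPS, Subring.closure_le]
    rintro _ ⟨i, hi, him, rfl⟩
    exact Subring.subset_closure ⟨i, hi, him, rfl⟩
  exact hle hf

theorem stmt13 (m : ℕ) (hm : 0 < m) (l : ℤ) (hl : l = 2 * m + 1)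
    (r : ℤ) (hr : IsCoprime r l) (u v : MvPolynomial (Fin m) (ZMod 2))
    (h : Nideal m ⊔ Ideal.span {v} = Nideal m ⊔ Ideal.span {u, v}) :
    (∃ s ∈ SringPS l m, phi l m r u = s * phi l m r v) ∧
      (phi l m r v ≠ 0 →
        ((phi l m r u : LaurentSeries (ZMod 2)) / (phi l m r v : LaurentSeries (ZMod 2))) ∈
          Sring l m) := by
  subst hl
  have hu : u ∈ Nideal m ⊔ Ideal.span {v} := by
    rw [h]
    exact Ideal.mem_sup_right (Ideal.subset_span (by simp))
  obtain ⟨n, hn, w, hw, rfl⟩ := Submodule.mem_sup.1 hu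
  obtain ⟨s, rfl⟩ := Ideal.mem_span_singleton'.1 hw
  have hn0 : phi (2 * m + 1) m r n = 0 := Nideal_le_ker_phi m r hn
  have huv : phi (2 * m + 1) m r (n + s * v) =
      phi (2 * m + 1) m r s * phi (2 * m + 1) m r v := by
    rw [map_add, hn0, zero_add, map_mul]
  have hs := phi_mem_SringPS hr s
  refine ⟨⟨_, hs, huv⟩, fun hv => ?_⟩
  have hv' : (phi (2 * m + 1) m r v : LaurentSeries (ZMod 2)) ≠ 0 := fun h0 =>
    hv (HahnSeries.ofPowerSeries_injective (h0.trans (map_zero _).symm))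
  rw [huv, PowerSeries.coe_mul, mul_div_cancel_right₀ _ hv']
  exact coe_mem_Sring hs
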